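/- Let θ ∈ (0,1), let m be a positive integer that is not a power of 2, set N = 2^⌈log₂ m⌉ − m, and let δ = ρ/(2τ) where ρ, τ are positive integers with ρ ≤ τ. Then the average code-length of the modified Rice–Golomb code satisfies ∫_ℝ ℓ(ε)·f_θ(ε) dε = 1 + ⌊log₂ m⌋ + (1/2)·(θ^(N/2)/(1 − θ^(m/2)))·(θ^δ + θ^(−δ)). -/

import Mathlib

open MeasureTheory

/-- The Laplace density `f_θ(ε) = (-(log θ) / 2) * θ ^ |ε|` with scale parameter `θ`. -/
noncomputable def laplaceDensity (θ ε : ℝ) : ℝ := (-Real.log θ / 2) * θ ^ |ε|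

lemma laplaceDensity_nonneg {θ : ℝ} (hθ : θ ∈ Set.Ioo (0 : ℝ) 1) (ε : ℝ) :
    0 ≤ laplaceDensity θ ε :=
  mul_nonneg (by linarith [Real.log_neg hθ.1 hθ.2]) (Real.rpow_nonneg hθ.1.le _)

lemma laplaceDensity_neg (θ ε : ℝ) : laplaceDensity θ (-ε) = laplaceDensity θ ε := by
  simp [laplaceDensity]

lemma laplaceDensity_eqOn_Ioi {θ s : ℝ} (hθ : θ ∈ Set.Ioo (0 : ℝ) 1) (hs : 0 ≤ s) :
    Set.EqOn (fun ε => (-Real.log θ / 2) * Real.exp (Real.log θ * ε)) (laplaceDensity θ)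
      (Set.Ioi s) := by
  intro ε hε
  simp only [laplaceDensity]
  rw [abs_of_pos (hs.trans_lt hε), Real.rpow_def_of_pos hθ.1]

lemma integrableOn_laplaceDensity_Ioi {θ s : ℝ} (hθ : θ ∈ Set.Ioo (0 : ℝ) 1) (hs : 0 ≤ s) :
    IntegrableOn (laplaceDensity θ) (Set.Ioi s) :=
  IntegrableOn.congr_fun ((integrableOn_exp_mul_Ioi (Real.log_neg hθ.1 hθ.2) s).const_mul _)
    (laplaceDensity_eqOn_Ioi hθ hs) measurableSet_Ioi

lemma integral_laplaceDensity_Ioi {θ s : ℝ} (hθ : θ ∈ Set.Ioo (0 : ℝ) 1) (hs : 0 ≤ s) :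
    ∫ ε in Set.Ioi s, laplaceDensity θ ε = θ ^ s / 2 := by
  have hlog := Real.log_neg hθ.1 hθ.2
  rw [← setIntegral_congr_fun measurableSet_Ioi (laplaceDensity_eqOn_Ioi hθ hs),
    integral_const_mul, integral_exp_mul_Ioi hlog, Real.rpow_def_of_pos hθ.1]
  have := hlog.ne
  field_simp

lemma integrableOn_laplaceDensity_Iic {θ t : ℝ} (hθ : θ ∈ Set.Ioo (0 : ℝ) 1) (ht : 0 ≤ t) :
    IntegrableOn (laplaceDensity θ) (Set.Iic (-t)) := by
  have hlog : 0 < -Real.log θ := neg_pos.mpr (Real.log_neg hθ.1 hθ.2)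
  refine IntegrableOn.congr_fun
    ((integrableOn_exp_mul_Iic hlog (-t)).const_mul (-Real.log θ / 2)) (fun ε hε => ?_)
    measurableSet_Iic
  simp only [laplaceDensity]
  rw [abs_of_nonpos (hε.trans (neg_nonpos.mpr ht)), Real.rpow_def_of_pos hθ.1, mul_neg, neg_mul]

lemma integral_laplaceDensity_Iic {θ t : ℝ} (hθ : θ ∈ Set.Ioo (0 : ℝ) 1) (ht : 0 ≤ t) :
    ∫ ε in Set.Iic (-t), laplaceDensity θ ε = θ ^ t / 2 := by
  rw [← integral_comp_neg_Ioi]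
  simp_rw [laplaceDensity_neg]
  exact integral_laplaceDensity_Ioi hθ ht

lemma integrable_laplaceDensity {θ : ℝ} (hθ : θ ∈ Set.Ioo (0 : ℝ) 1) :
    Integrable (laplaceDensity θ) := by
  rw [← integrableOn_univ, ← Set.Iic_union_Ioi (a := (0 : ℝ))]
  have h := integrableOn_laplaceDensity_Iic hθ le_rfl
  rw [neg_zero] at h
  exact h.union (integrableOn_laplaceDensity_Ioi hθ le_rfl)

lemma integral_laplaceDensity {θ : ℝ} (hθ : θ ∈ Set.Ioo (0 : ℝ) 1) :
    ∫ ε, laplaceDensity θ ε = 1 := by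
  have h := integral_laplaceDensity_Iic hθ le_rfl
  rw [neg_zero] at h
  rw [← intervalIntegral.integral_Iic_add_Ioi (b := 0) (integrable_laplaceDensity hθ).integrableOn
    (integrable_laplaceDensity hθ).integrableOn, h, integral_laplaceDensity_Ioi hθ le_rfl,
    Real.rpow_zero]
  norm_num

/-- The mass that the Laplace distribution gives to `{ε | a ≤ |ε + δ|}`, for `0 ≤ δ ≤ a`. -/
lemma setIntegral_laplaceDensity_le_abs_add {θ δ a : ℝ} (hθ : θ ∈ Set.Ioo (0 : ℝ) 1)
    (hδ : 0 ≤ δ) (ha : 0 < a) (hδa : δ ≤ a) :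
    ∫ ε in {ε | a ≤ |ε + δ|}, laplaceDensity θ ε = θ ^ a / 2 * (θ ^ δ + θ ^ (-δ)) := by
  have hset : {ε : ℝ | a ≤ |ε + δ|} = Set.Iic (-(a + δ)) ∪ Set.Ici (a - δ) := by
    ext ε
    simp only [Set.mem_ofPred_eq, Set.mem_union, Set.mem_Iic, Set.mem_Ici, le_abs]
    constructor
    · rintro (h | h)
      · right; linarith
      · left; linarith
    · rintro (h | h)
      · right; linarith
      · left; linarith
  have hdisj : Disjoint (Set.Iic (-(a + δ))) (Set.Ici (a - δ)) :=
    Set.Iic_disjoint_Ici.mpr (by linarith)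
  rw [hset, setIntegral_union hdisj measurableSet_Ici
    (integrable_laplaceDensity hθ).integrableOn (integrable_laplaceDensity hθ).integrableOn,
    integral_laplaceDensity_Iic hθ (by linarith), integral_Ici_eq_integral_Ioi,
    integral_laplaceDensity_Ioi hθ (by linarith), sub_eq_add_neg, Real.rpow_add hθ.1,
    Real.rpow_add hθ.1]
  ring

/-- The number of thresholds `N, N + m, N + 2 * m, …` that do not exceed `x`. -/
lemma hasSum_thresholds {m : ℝ} (hm : 0 < m) (N x : ℝ) :
    HasSum (fun k : ℕ => if N + k * m ≤ x then (1 : ℝ) else 0)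
      (if x < N then 0 else 1 + (⌊(x - N) / m⌋ : ℝ)) := by
  split_ifs with hx
  · convert hasSum_zero with k
    rw [if_neg]
    nlinarith [mul_nonneg (Nat.cast_nonneg (α := ℝ) k) hm.le]
  · have hq : 0 ≤ (x - N) / m := div_nonneg (by linarith) hm.le
    have hiff (k : ℕ) : N + k * m ≤ x ↔ k ∈ Finset.range (⌊(x - N) / m⌋₊ + 1) := by
      rw [Finset.mem_range, Nat.lt_succ_iff, Nat.le_floor_iff hq, le_div_iff₀ hm,
        le_sub_iff_add_le']
    simp_rw [hiff]
    have h := hasSum_sum_of_ne_finset_zero (L := .unconditional ℕ)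
      (f := fun k : ℕ => if k ∈ Finset.range (⌊(x - N) / m⌋₊ + 1) then (1 : ℝ) else 0)
      (s := Finset.range (⌊(x - N) / m⌋₊ + 1)) (fun k hk => if_neg hk)
    convert h using 1
    rw [Finset.sum_ite_mem, Finset.inter_self, Finset.sum_const, Finset.card_range,
      ← natCast_floor_eq_intCast_floor hq]
    simp [add_comm]

lemma two_pow_clog_sub_pos {m : ℕ} (hnp : ¬ ∃ β : ℕ, m = 2 ^ β) : 0 < 2 ^ Nat.clog 2 m - m :=
  Nat.sub_pos_of_lt <| (Nat.le_pow_clog one_lt_two m).lt_of_ne fun h => hnp ⟨_, h⟩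

/-- The average number of thresholds `N, N + m, N + 2 * m, …` not exceeding `2 * |ε + δ|`, for
`ε` distributed according to the Laplace density. -/
lemma integral_thresholds_mul_laplaceDensity {θ δ N m : ℝ} (hθ : θ ∈ Set.Ioo (0 : ℝ) 1)
    (hδ : 0 ≤ δ) (hN : 0 < N) (hδN : δ ≤ N / 2) (hm : 0 < m) :
    ∫ ε, (if 2 * |ε + δ| < N then 0 else 1 + (⌊(2 * |ε + δ| - N) / m⌋ : ℝ)) *
        laplaceDensity θ ε
      = (1 / 2) * (θ ^ (N / 2) / (1 - θ ^ (m / 2))) * (θ ^ δ + θ ^ (-δ)) := by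
  set S : ℕ → Set ℝ := fun k => {ε | (N + k * m) / 2 ≤ |ε + δ|} with hS
  have hmeas (k : ℕ) : MeasurableSet (S k) :=
    measurableSet_le measurable_const (by fun_prop)
  have hint (k : ℕ) : Integrable ((S k).indicator (laplaceDensity θ)) :=
    (integrable_laplaceDensity hθ).indicator (hmeas k)
  have hval (k : ℕ) : ∫ ε, (S k).indicator (laplaceDensity θ) ε =
      θ ^ (N / 2) / 2 * (θ ^ δ + θ ^ (-δ)) * (θ ^ (m / 2)) ^ k := by
    have hk : 0 ≤ k * m := by positivity
    rw [integral_indicator (hmeas k),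
      setIntegral_laplaceDensity_le_abs_add hθ hδ (by positivity) (by linarith),
      show (N + k * m) / 2 = N / 2 + m / 2 * k by ring, Real.rpow_add hθ.1,
      Real.rpow_mul hθ.1.le, Real.rpow_natCast]
    ring
  have hgeom := (hasSum_geometric_of_lt_one (Real.rpow_nonneg hθ.1.le (m / 2))
    (Real.rpow_lt_one hθ.1.le hθ.2 (half_pos hm))).mul_left
      (θ ^ (N / 2) / 2 * (θ ^ δ + θ ^ (-δ)))
  have hnorm (k : ℕ) : ∫ ε, ‖(S k).indicator (laplaceDensity θ) ε‖ =
      ∫ ε, (S k).indicator (laplaceDensity θ) ε :=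
    integral_congr_ae <| .of_forall fun ε =>
      Real.norm_of_nonneg (Set.indicator_nonneg (fun ε _ => laplaceDensity_nonneg hθ ε) ε)
  have hsum := hasSum_integral_of_summable_integral_norm hint
    (by simp_rw [hnorm, hval]; exact hgeom.summable)
  simp_rw [hval] at hsum
  have htsum (ε : ℝ) : ∑' k, (S k).indicator (laplaceDensity θ) ε =
      (if 2 * |ε + δ| < N then 0 else 1 + (⌊(2 * |ε + δ| - N) / m⌋ : ℝ)) *
        laplaceDensity θ ε := by
    rw [← ((hasSum_thresholds hm N (2 * |ε + δ|)).mul_right _).tsum_eq]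
    refine tsum_congr fun k => ?_
    simp only [hS, Set.indicator_apply, Set.mem_ofPred_eq, ite_mul, one_mul, zero_mul,
      div_le_iff₀' (two_pos (α := ℝ))]
  simp_rw [htsum] at hsum
  rw [hsum.unique hgeom]
  ring

/-- average code-length of the modified Rice–Golomb code when `m` is not
a power of 2. Here `⌊log₂ m⌋ = Nat.log 2 m`, `⌈log₂ m⌉ = Nat.clog 2 m` and
`N = 2 ^ ⌈log₂ m⌉ - m`. -/
theorem avg_code_length_not_pow_two (θ : ℝ) (hθ : θ ∈ Set.Ioo (0:ℝ) 1)
    (m : ℕ) (hm : 0 < m) (hnp : ¬ ∃ β : ℕ, m = 2 ^ β)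
    (ρ τ : ℕ) (hρ : 0 < ρ) (hτ : 0 < τ) (hρτ : ρ ≤ τ)
    (N : ℕ) (hN : N = 2 ^ Nat.clog 2 m - m) (δ : ℝ) (hδ : δ = (ρ : ℝ) / (2 * τ)) :
    ∫ ε : ℝ, ((if 2 * |ε + δ| < (N : ℝ) then 1 + (Nat.log 2 m : ℝ)
          else 2 + (Nat.log 2 m : ℝ) + (⌊(2 * |ε + δ| - (N : ℝ)) / (m : ℝ)⌋ : ℝ)) *
        ((-Real.log θ / 2) * θ ^ |ε|))
      = 1 + (Nat.log 2 m : ℝ) +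
        (1/2) * (θ ^ ((N : ℝ)/2) / (1 - θ ^ ((m : ℝ)/2))) * (θ ^ δ + θ ^ (-δ)) := by
  obtain ⟨hθ0, hθ1⟩ := id hθ
  have hmR : (0 : ℝ) < m := by exact_mod_cast hm
  have hτR : (0 : ℝ) < τ := by exact_mod_cast hτ
  have hN1 : (1 : ℝ) ≤ N := by exact_mod_cast hN ▸ two_pow_clog_sub_pos hnp
  have hδ0 : 0 ≤ δ := by rw [hδ]; positivity
  have hδN : δ ≤ N / 2 := by
    have : δ ≤ 1 / 2 := by
      rw [hδ, div_le_div_iff₀ (by positivity) two_pos]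
      have : (ρ : ℝ) ≤ τ := by exact_mod_cast hρτ
      linarith
    linarith
  have hmain := integral_thresholds_mul_laplaceDensity hθ hδ0 (by linarith) hδN hmR
  have hpos : 0 < (1 / 2) * (θ ^ ((N : ℝ) / 2) / (1 - θ ^ ((m : ℝ) / 2))) *
      (θ ^ δ + θ ^ (-δ)) := by
    have := sub_pos.mpr (Real.rpow_lt_one hθ0.le hθ1 (half_pos hmR))
    positivity
  have hint := Integrable.of_integral_ne_zero (hmain.trans_ne hpos.ne')
  have hconst : ∫ ε, (1 + (Nat.log 2 m : ℝ)) * laplaceDensity θ ε = 1 + (Nat.log 2 m : ℝ) := by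
    rw [integral_const_mul, integral_laplaceDensity hθ, mul_one]
  rw [← hmain]
  nth_rewrite 2 [← hconst]
  rw [← integral_add ((integrable_laplaceDensity hθ).const_mul _) hint]
  refine integral_congr_ae <| .of_forall fun ε => ?_
  simp only [laplaceDensity]
  split_ifs <;> ring
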